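/- For every ε > 0 there exists a C^∞ function ψ on (a neighbourhood of) B × [0,T] such that (i) u(x,t) ≤ ψ(x,t) ≤ u(x,t) + (T+2)ε for all (x,t) ∈ B × [0,T] (in particular sup_{(x,t)∈B×[0,T]} |ψ(x,t) − u(x,t)| ≤ (T+2)ε); (ii) ∂_t ψ(x,t) + ⟨∇_x ψ(x,t), f(x,d)⟩ ≤ 0 for all (x,t,d) ∈ B × [0,T] × 𝒟; (iii) ψ(x,t) ≥ g_i(x,t) for all (x,t) ∈ B × [0,T] and all i = 1,…,n_X; (iv) ψ(x,T) ≥ l_j(x) for all x ∈ B and all j = 1,…,n_TR. -/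

import Mathlib

open Set MeasureTheory RealInnerProductSpace Filter Topology

noncomputable section

abbrev EucSp (n : ℕ) : Type := EuclideanSpace ℝ (Fin n)

/-- An admissible uncertainty on `[t, T]`: a measurable map taking values in `D` there. -/
def Admissible {m : ℕ} (D : Set (EucSp m)) (t T : ℝ) (d : ℝ → EucSp m) : Prop :=
  Measurable d ∧ ∀ s ∈ Set.Icc t T, d s ∈ D

/-- `y` solves `ẏ(s) = F (y s) (d s)` on `[t, T]` with `y t = x` (integral form,
equivalent to absolute continuity together with the a.e. differential equation). -/
def IsTraj {n m : ℕ} (F : EucSp n → EucSp m → EucSp n) (d : ℝ → EucSp m)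
    (t T : ℝ) (x : EucSp n) (y : ℝ → EucSp n) : Prop :=
  y t = x ∧ ∀ s ∈ Set.Icc t T, y s = x + ∫ r in t..s, F (y r) (d r)

/-- The payoff of a trajectory `y` on `[t, T]`:
`max { max_j l_j (y T), max_i sup_{s ∈ [t,T]} g_i (y s, s) }`. -/
def payoff {n nX nTR : ℕ} (g : Fin nX → EucSp n → ℝ → ℝ) (l : Fin nTR → EucSp n → ℝ)
    (t T : ℝ) (y : ℝ → EucSp n) : ℝ :=
  max (⨆ j, l j (y T)) (⨆ i, sSup ((fun s => g i (y s) s) '' Set.Icc t T))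

/-- The defining property of the value function `u`: for `(x, t) ∈ ℝⁿ × [0, T]`,
`u (x, t)` is the supremum of the payoffs over all admissible uncertainties on `[t, T]`
(the trajectory being the unique solution of the ODE driven by the uncertainty). -/
def IsValueFun {n m nX nTR : ℕ} (F : EucSp n → EucSp m → EucSp n) (D : Set (EucSp m))
    (g : Fin nX → EucSp n → ℝ → ℝ) (l : Fin nTR → EucSp n → ℝ) (T : ℝ)
    (u : EucSp n → ℝ → ℝ) : Prop :=
  ∀ x : EucSp n, ∀ t ∈ Set.Icc (0:ℝ) T,
    u x t = sSup {r | ∃ d y, Admissible D t T d ∧ IsTraj F d t T x y ∧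
      r = payoff g l t T y}

/-- The Hamiltonian `H(x, p) = max_{d ∈ D} ⟪p, F x d⟫`. -/
def Ham {n m : ℕ} (F : EucSp n → EucSp m → EucSp n) (D : Set (EucSp m))
    (x p : EucSp n) : ℝ :=
  sSup ((fun d => ⟪p, F x d⟫) '' D)

/-- Viscosity super-solution of `max{∂ₜ w + H(x, ∇ₓ w), maxᵢ gᵢ(x,t) - w} = 0` on
`ℝⁿ × [0, T]`: a lower semicontinuous function such that for every smooth test function
`ψ` such that `w - ψ` attains a local minimum at `(x₀, t₀) ∈ ℝⁿ × [0, T]`, one has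
`max{∂ₜ ψ(x₀,t₀) + H(x₀, ∇ₓ ψ(x₀,t₀)), maxᵢ gᵢ(x₀,t₀) - w(x₀,t₀)} ≤ 0`. -/
def ViscSuper {n m nX : ℕ} (F : EucSp n → EucSp m → EucSp n) (D : Set (EucSp m))
    (g : Fin nX → EucSp n → ℝ → ℝ) (T : ℝ) (w : EucSp n → ℝ → ℝ) : Prop :=
  LowerSemicontinuousOn (fun p : EucSp n × ℝ => w p.1 p.2) (Set.univ ×ˢ Set.Icc 0 T) ∧
  ∀ ψ : EucSp n → ℝ → ℝ, ContDiff ℝ (⊤ : ℕ∞) (fun p : EucSp n × ℝ => ψ p.1 p.2) →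
    ∀ x₀ : EucSp n, ∀ t₀ ∈ Set.Icc (0:ℝ) T,
      IsLocalMinOn (fun p : EucSp n × ℝ => w p.1 p.2 - ψ p.1 p.2)
        (Set.univ ×ˢ Set.Icc 0 T) (x₀, t₀) →
      max (deriv (ψ x₀) t₀ + Ham F D x₀ (gradient (fun z => ψ z t₀) x₀))
        ((⨆ i, g i x₀ t₀) - w x₀ t₀) ≤ 0

/-- Viscosity sub-solution of `max{∂ₜ w + H(x, ∇ₓ w), maxᵢ gᵢ(x,t) - w} = 0` on
`ℝⁿ × [0, T]`. -/
def ViscSub {n m nX : ℕ} (F : EucSp n → EucSp m → EucSp n) (D : Set (EucSp m))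
    (g : Fin nX → EucSp n → ℝ → ℝ) (T : ℝ) (w : EucSp n → ℝ → ℝ) : Prop :=
  UpperSemicontinuousOn (fun p : EucSp n × ℝ => w p.1 p.2) (Set.univ ×ˢ Set.Icc 0 T) ∧
  ∀ ψ : EucSp n → ℝ → ℝ, ContDiff ℝ (⊤ : ℕ∞) (fun p : EucSp n × ℝ => ψ p.1 p.2) →
    ∀ x₀ : EucSp n, ∀ t₀ ∈ Set.Icc (0:ℝ) T,
      IsLocalMaxOn (fun p : EucSp n × ℝ => w p.1 p.2 - ψ p.1 p.2)
        (Set.univ ×ˢ Set.Icc 0 T) (x₀, t₀) →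
      0 ≤ max (deriv (ψ x₀) t₀ + Ham F D x₀ (gradient (fun z => ψ z t₀) x₀))
        ((⨆ i, g i x₀ t₀) - w x₀ t₀)

/-- The backward reachable set at time `t` (horizon `T`) of the target `{maxⱼ lⱼ ≤ 0}`
under state constraints `{maxᵢ gᵢ(·, s) ≤ 0}`, for the dynamics `f` driven by
uncertainties in `D`: the set of `x` such that for every admissible uncertainty the
(unique) solution extends to all of `[t, T]`, respects the state constraints there,
and ends up in the target at time `T`. -/
def Reach {n m nX nTR : ℕ} (f : EucSp n → EucSp m → EucSp n) (D : Set (EucSp m))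
    (g : Fin nX → EucSp n → ℝ → ℝ) (l : Fin nTR → EucSp n → ℝ)
    (t T : ℝ) : Set (EucSp n) :=
  {x | ∀ d, Admissible D t T d → ∃ y, IsTraj f d t T x y ∧
    (∀ s ∈ Set.Icc t T, ∀ i, g i (y s) s ≤ 0) ∧ ∀ j, l j (y T) ≤ 0}

/-- `F` is continuous, `L`-Lipschitz in the state uniformly over `D`, and bounded by `M` at the
origin. -/
structure IsLipField {n m : ℕ} (F : EucSp n → EucSp m → EucSp n) (D : Set (EucSp m))
    (L M : ℝ) : Prop where
  continuous : Continuous fun p : EucSp n × EucSp m => F p.1 p.2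
  nonneg_lip : 0 ≤ L
  nonneg_bound : 0 ≤ M
  lip : ∀ x y : EucSp n, ∀ d ∈ D, ‖F x d - F y d‖ ≤ L * ‖x - y‖
  bound : ∀ d ∈ D, ‖F 0 d‖ ≤ M

/-- Integral form of Gronwall's inequality. -/
theorem le_mul_exp_of_le_add_integral {φ : ℝ → ℝ} {a b A L : ℝ} (hL : 0 ≤ L)
    (hφ : ContinuousOn φ (Icc a b))
    (h : ∀ s ∈ Icc a b, φ s ≤ A + L * ∫ r in a..s, φ r) :
    ∀ s ∈ Icc a b, φ s ≤ A * Real.exp (L * (s - a)) := by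
  intro s hs
  have hab : a ≤ b := hs.1.trans hs.2
  have hint : IntegrableOn φ (uIcc a b) := by
    rw [uIcc_of_le hab]; exact hφ.integrableOn_Icc
  have hcont : ContinuousOn (fun s => ∫ r in a..s, φ r) (Icc a b) := by
    have := intervalIntegral.continuousOn_primitive_interval hint
    rwa [uIcc_of_le hab] at this
  have hderiv : ∀ s ∈ Ioo a b, HasDerivAt (fun s => ∫ r in a..s, φ r) (φ s) s := by
    intro s hs
    have hc : ContinuousAt φ s := hφ.continuousAt (Icc_mem_nhds hs.1 hs.2)
    refine intervalIntegral.integral_hasDerivAt_right ?_ ?_ hc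
    · apply ContinuousOn.intervalIntegrable
      rw [uIcc_of_le hs.1.le]
      exact hφ.mono (Icc_subset_Icc_right hs.2.le)
    · exact (hφ.mono Ioo_subset_Icc_self).stronglyMeasurableAtFilter isOpen_Ioo s hs
  have hderiv2 : ∀ s ∈ Ioo a b, HasDerivAt
      (fun s => Real.exp (-(L * (s - a))) * (A + L * ∫ r in a..s, φ r))
      (Real.exp (-(L * (s - a))) * (-L) * (A + L * ∫ r in a..s, φ r)
        + Real.exp (-(L * (s - a))) * (L * φ s)) s := by
    intro s hs
    have h1 : HasDerivAt (fun s => -(L * (s - a))) (-L) s := by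
      simpa using (((hasDerivAt_id s).sub_const a).const_mul L).fun_neg
    exact h1.exp.mul (((hderiv s hs).const_mul L).const_add A)
  have hanti : AntitoneOn
      (fun s => Real.exp (-(L * (s - a))) * (A + L * ∫ r in a..s, φ r)) (Icc a b) := by
    apply antitoneOn_of_deriv_nonpos (convex_Icc a b)
    · exact (by fun_prop : Continuous fun s => Real.exp (-(L * (s - a)))).continuousOn.mul
        (continuousOn_const.add (continuousOn_const.mul hcont))
    · rw [interior_Icc]
      exact fun s hs => (hderiv2 s hs).differentiableAt.differentiableWithinAt
    · rw [interior_Icc]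
      intro s hs
      rw [(hderiv2 s hs).deriv]
      have h1 := h s (Ioo_subset_Icc_self hs)
      have h2 : 0 ≤ Real.exp (-(L * (s - a))) * L := by positivity
      nlinarith
  have hle := hanti (left_mem_Icc.2 hab) hs hs.1
  simp only [sub_self, mul_zero, neg_zero, Real.exp_zero, intervalIntegral.integral_same,
    add_zero, one_mul] at hle
  rw [Real.exp_neg, inv_mul_le_iff₀ (Real.exp_pos _)] at hle
  linarith [h s hs, mul_comm (Real.exp (L * (s - a))) A]

section Trajectories

variable {n m : ℕ} {F : EucSp n → EucSp m → EucSp n} {D : Set (EucSp m)} {L M : ℝ}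
  {d : ℝ → EucSp m} {a b : ℝ} {x : EucSp n} {y : ℝ → EucSp n}

theorem IsLipField.norm_le (hF : IsLipField F D L M) (x : EucSp n) {d : EucSp m} (hd : d ∈ D) :
    ‖F x d‖ ≤ M + L * ‖x‖ := by
  have h1 := hF.lip x 0 d hd
  have h2 := hF.bound d hd
  have h3 : ‖F x d‖ ≤ ‖F x d - F 0 d‖ + ‖F 0 d‖ := norm_le_norm_sub_add _ _
  rw [sub_zero] at h1
  linarith

theorem IsLipField.aestronglyMeasurable (hF : IsLipField F D L M) (hd : Measurable d)
    {s : Set ℝ} (hs : MeasurableSet s) (hy : ContinuousOn y s) :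
    AEStronglyMeasurable (fun r => F (y r) (d r)) (volume.restrict s) :=
  hF.continuous.comp_aestronglyMeasurable
    ((hy.aestronglyMeasurable hs).prodMk hd.aestronglyMeasurable)

theorem IsLipField.integrableOn (hF : IsLipField F D L M) (hd : Measurable d)
    (hdD : ∀ r, d r ∈ D) {s : Set ℝ} (hs : MeasurableSet s) (hs' : volume s ≠ ⊤)
    (hy : ContinuousOn y s) {C : ℝ} (hC : ∀ r ∈ s, ‖y r‖ ≤ C) :
    IntegrableOn (fun r => F (y r) (d r)) s := by
  have : IsFiniteMeasure (volume.restrict s) := isFiniteMeasure_restrict.2 hs'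
  refine Integrable.of_bound (hF.aestronglyMeasurable hd hs hy) (M + L * C) ?_
  filter_upwards [ae_restrict_mem hs] with r hr
  have := hF.norm_le (y r) (hdD r)
  have := mul_le_mul_of_nonneg_left (hC r hr) hF.nonneg_lip
  linarith

theorem IsLipField.intervalIntegrable (hF : IsLipField F D L M) (hd : Measurable d)
    (hdD : ∀ r, d r ∈ D) (hab : a ≤ b) (hy : ContinuousOn y (Icc a b)) :
    IntervalIntegrable (fun r => F (y r) (d r)) volume a b := by
  rw [intervalIntegrable_iff_integrableOn_Icc_of_le hab]
  obtain ⟨C, hC⟩ := isCompact_Icc.exists_bound_of_continuousOn hy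
  exact hF.integrableOn hd hdD measurableSet_Icc (by simp) hy hC

theorem IsTraj.norm_le_of_continuousOn (hF : IsLipField F D L M)
    (hdD : ∀ r, d r ∈ D) (hy : IsTraj F d a b x y) (hc : ContinuousOn y (Icc a b)) :
    ∀ s ∈ Icc a b, ‖y s‖ ≤ (‖x‖ + M * (b - a)) * Real.exp (L * (b - a)) := by
  intro s hs
  have hab : a ≤ b := hs.1.trans hs.2
  have hA : 0 ≤ ‖x‖ + M * (b - a) :=
    add_nonneg (norm_nonneg _) (mul_nonneg hF.nonneg_bound (sub_nonneg.2 hab))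
  refine (le_mul_exp_of_le_add_integral hF.nonneg_lip (A := ‖x‖ + M * (b - a)) hc.norm ?_
    s hs).trans ?_
  · intro s hs
    rw [hy.2 s hs]
    have hci : IntervalIntegrable (fun r => ‖y r‖) volume a s := by
      apply ContinuousOn.intervalIntegrable
      rw [uIcc_of_le hs.1]
      exact (hc.mono (Icc_subset_Icc_right hs.2)).norm
    have h1 : ‖∫ r in a..s, F (y r) (d r)‖ ≤ ∫ r in a..s, (M + L * ‖y r‖) :=
      intervalIntegral.norm_integral_le_of_norm_le hs.1
        (Eventually.of_forall fun r _ => hF.norm_le _ (hdD r))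
        (intervalIntegrable_const.add (hci.const_mul L))
    rw [intervalIntegral.integral_add intervalIntegrable_const (hci.const_mul L),
      intervalIntegral.integral_const_mul, intervalIntegral.integral_const, smul_eq_mul] at h1
    have h2 := norm_add_le x (∫ r in a..s, F (y r) (d r))
    have h3 : (s - a) * M ≤ M * (b - a) := by nlinarith [hF.nonneg_bound, hs.2]
    linarith
  · refine mul_le_mul_of_nonneg_left (Real.exp_le_exp.2 ?_) hA
    exact mul_le_mul_of_nonneg_left (by linarith [hs.2]) hF.nonneg_lip

theorem IsTraj.mono_right {c : ℝ} (hy : IsTraj F d a b x y) (hc : c ≤ b) :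
    IsTraj F d a c x y :=
  ⟨hy.1, fun s hs => hy.2 s ⟨hs.1, hs.2.trans hc⟩⟩

theorem IsTraj.continuousOn_of_intervalIntegrable (hy : IsTraj F d a b x y) (hab : a ≤ b)
    (hi : IntervalIntegrable (fun r => F (y r) (d r)) volume a b) :
    ContinuousOn y (Icc a b) := by
  have h := intervalIntegral.continuousOn_primitive_interval' hi left_mem_uIcc
  rw [uIcc_of_le hab] at h
  exact (continuousOn_const.add h).congr fun s hs => hy.2 s hs

/-- The integrand of the integral equation is automatically integrable. -/
theorem IsTraj.intervalIntegrable (hF : IsLipField F D L M) (hd : Measurable d)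
    (hdD : ∀ r, d r ∈ D) (hab : a ≤ b) (hy : IsTraj F d a b x y) :
    IntervalIntegrable (fun r => F (y r) (d r)) volume a b := by
  set I : Set ℝ := {s | s ∈ Icc a b ∧ IntervalIntegrable (fun r => F (y r) (d r)) volume a s}
    with hI
  have haI : a ∈ I := ⟨left_mem_Icc.2 hab, IntervalIntegrable.refl⟩
  have hbdd : BddAbove I := ⟨b, fun s hs => hs.1.2⟩
  set c := sSup I with hc
  have hac : a ≤ c := le_csSup hbdd haI
  have hcb : c ≤ b := csSup_le ⟨a, haI⟩ fun s hs => hs.1.2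
  have hlow : ∀ s ∈ Ico a c, s ∈ I := by
    intro s hs
    obtain ⟨r, hr, hsr⟩ := exists_lt_of_lt_csSup ⟨a, haI⟩ hs.2
    refine ⟨⟨hs.1, hsr.le.trans hr.1.2⟩, hr.2.mono_set ?_⟩
    rw [uIcc_of_le hs.1, uIcc_of_le hr.1.1]
    exact Icc_subset_Icc_right hsr.le
  have hcs : ∀ s ∈ Ico a c, ContinuousOn y (Icc a s) := fun s hs =>
    (hy.mono_right (hlow s hs).1.2).continuousOn_of_intervalIntegrable hs.1 (hlow s hs).2
  have hcont : ContinuousOn y (Ico a c) := by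
    intro s hs
    obtain ⟨r, hsr, hrc⟩ := exists_between hs.2
    refine ((hcs r ⟨hs.1.trans hsr.le, hrc⟩) s ⟨hs.1, hsr.le⟩).mono_of_mem_nhdsWithin ?_
    filter_upwards [self_mem_nhdsWithin, mem_nhdsWithin_of_mem_nhds (Iio_mem_nhds hsr)]
      with z hz hz'
    exact ⟨hz.1, le_of_lt hz'⟩
  have hbound : ∀ s ∈ Ico a c, ‖y s‖ ≤ (‖x‖ + M * (b - a)) * Real.exp (L * (b - a)) := by
    intro s hs
    refine ((hy.mono_right (hlow s hs).1.2).norm_le_of_continuousOn hF hdD (hcs s hs) s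
      ⟨hs.1, le_rfl⟩).trans ?_
    have h1 : s - a ≤ b - a := by linarith [(hlow s hs).1.2]
    have h2 : 0 ≤ s - a := sub_nonneg.2 hs.1
    have := hF.nonneg_lip
    have := hF.nonneg_bound
    gcongr
  have h1 : IntegrableOn (fun r => F (y r) (d r)) (Ico a c) :=
    hF.integrableOn hd hdD measurableSet_Ico (by simp) hcont hbound
  have hup : ∀ s ∈ Ioc c b, y s = x := by
    intro s hs
    have hsI : s ∉ I := fun h => absurd (le_csSup hbdd h) (not_le.2 hs.1)
    have hs' : s ∈ Icc a b := ⟨hac.trans hs.1.le, hs.2⟩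
    rw [hy.2 s hs', intervalIntegral.integral_undef fun h => hsI ⟨hs', h⟩, add_zero]
  have h2 : IntegrableOn (fun r => F (y r) (d r)) (Ioc c b) :=
    hF.integrableOn hd hdD measurableSet_Ioc (by simp)
      (continuousOn_const.congr hup) (C := ‖x‖) fun s hs => (congrArg norm (hup s hs)).le
  have h1' : IntervalIntegrable (fun r => F (y r) (d r)) volume a c := by
    rwa [intervalIntegrable_iff_integrableOn_Ico_of_le hac]
  have h2' : IntervalIntegrable (fun r => F (y r) (d r)) volume c b := by
    rwa [intervalIntegrable_iff_integrableOn_Ioc_of_le hcb]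
  exact h1'.trans h2'

theorem IsTraj.continuousOn (hF : IsLipField F D L M) (hd : Measurable d)
    (hdD : ∀ r, d r ∈ D) (hab : a ≤ b) (hy : IsTraj F d a b x y) : ContinuousOn y (Icc a b) :=
  hy.continuousOn_of_intervalIntegrable hab (hy.intervalIntegrable hF hd hdD hab)

theorem IsTraj.norm_le (hF : IsLipField F D L M) (hd : Measurable d)
    (hdD : ∀ r, d r ∈ D) (hab : a ≤ b) (hy : IsTraj F d a b x y) :
    ∀ s ∈ Icc a b, ‖y s‖ ≤ (‖x‖ + M * (b - a)) * Real.exp (L * (b - a)) :=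
  hy.norm_le_of_continuousOn hF hdD (hy.continuousOn hF hd hdD hab)

theorem IsTraj.mono_left {c : ℝ} (hF : IsLipField F D L M) (hd : Measurable d)
    (hdD : ∀ r, d r ∈ D) (hy : IsTraj F d a b x y) (hc : c ∈ Icc a b) :
    IsTraj F d c b (y c) y := by
  refine ⟨rfl, fun s hs => ?_⟩
  have hi := hy.intervalIntegrable hF hd hdD (hc.1.trans hc.2)
  have hs' : s ∈ Icc a b := ⟨hc.1.trans hs.1, hs.2⟩
  have h1 : IntervalIntegrable (fun r => F (y r) (d r)) volume a c := hi.mono_set (by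
    rw [uIcc_of_le hc.1, uIcc_of_le (hc.1.trans hc.2)]; exact Icc_subset_Icc_right hc.2)
  have h2 : IntervalIntegrable (fun r => F (y r) (d r)) volume c s := hi.mono_set (by
    rw [uIcc_of_le hs.1, uIcc_of_le (hc.1.trans hc.2)]; exact Icc_subset_Icc hc.1 hs.2)
  rw [hy.2 s hs', hy.2 c hc, add_assoc, intervalIntegral.integral_add_adjacent_intervals h1 h2]

theorem IsTraj.congr {d' : ℝ → EucSp m} {y' : ℝ → EucSp n} (hab : a ≤ b)
    (hy : IsTraj F d a b x y) (hdd : ∀ s ∈ Ioc a b, d s = d' s)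
    (hyy : ∀ s ∈ Icc a b, y s = y' s) : IsTraj F d' a b x y' := by
  refine ⟨(hyy a (left_mem_Icc.2 hab)).symm.trans hy.1, fun s hs => ?_⟩
  rw [← hyy s hs, hy.2 s hs]
  congr 1
  refine intervalIntegral.integral_congr_ae (Eventually.of_forall fun r hr => ?_)
  rw [uIoc_of_le hs.1] at hr
  rw [hyy r ⟨hr.1.le, hr.2.trans hs.2⟩, hdd r ⟨hr.1, hr.2.trans hs.2⟩]

theorem IsTraj.concat {c : ℝ} {d' : ℝ → EucSp m} {y' : ℝ → EucSp n} (hF : IsLipField F D L M)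
    (hd : Measurable d) (hdD : ∀ r, d r ∈ D) (hd' : Measurable d') (hdD' : ∀ r, d' r ∈ D)
    (hac : a ≤ c) (hcb : c ≤ b)
    (hy : IsTraj F d a c x y) (hy' : IsTraj F d' c b (y c) y') :
    IsTraj F (fun r => if r ≤ c then d r else d' r) a b x
      (fun r => if r ≤ c then y r else y' r) := by
  set e : ℝ → EucSp m := fun r => if r ≤ c then d r else d' r with he
  set z : ℝ → EucSp n := fun r => if r ≤ c then y r else y' r with hz
  have h1 : IsTraj F e a c x z := hy.congr hac (fun s hs => by simp [he, hs.2])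
    (fun s hs => by simp [hz, hs.2])
  have h2 : IsTraj F e c b (y c) z := by
    refine hy'.congr hcb (fun s hs => by simp [he, hs.1]) (fun s hs => ?_)
    rcases hs.1.eq_or_lt with rfl | h
    · simp [hz, hy'.1]
    · simp [hz, h]
  have hem : Measurable e := Measurable.ite measurableSet_Iic hd hd'
  have heD : ∀ r, e r ∈ D := fun r => by
    by_cases h : r ≤ c
    · simpa [he, h] using hdD r
    · simpa [he, h] using hdD' r
  refine ⟨h1.1, fun s hs => ?_⟩
  rcases le_total s c with h | h
  · exact h1.2 s ⟨hs.1, h⟩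
  · have hi1 := h1.intervalIntegrable hF hem heD hac
    have hi2 := (h2.mono_right hs.2).intervalIntegrable hF hem heD h
    have hzc := h1.2 c ⟨hac, le_rfl⟩
    rw [h2.2 s ⟨h, hs.2⟩, ← intervalIntegral.integral_add_adjacent_intervals hi1 hi2, ← add_assoc,
      ← hzc, h2.1]

theorem IsTraj.norm_sub_le {x' : EucSp n} {y' : ℝ → EucSp n} (hF : IsLipField F D L M)
    (hd : Measurable d) (hdD : ∀ r, d r ∈ D) (hab : a ≤ b)
    (hy : IsTraj F d a b x y) (hy' : IsTraj F d a b x' y') :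
    ∀ s ∈ Icc a b, ‖y s - y' s‖ ≤ ‖x - x'‖ * Real.exp (L * (b - a)) := by
  intro s hs
  have hc := hy.continuousOn hF hd hdD hab
  have hc' := hy'.continuousOn hF hd hdD hab
  refine (le_mul_exp_of_le_add_integral hF.nonneg_lip (hc.sub hc').norm (A := ‖x - x'‖) ?_
    s hs).trans ?_
  · intro s hs
    have hi := (hy.mono_right hs.2).intervalIntegrable hF hd hdD hs.1
    have hi' := (hy'.mono_right hs.2).intervalIntegrable hF hd hdD hs.1
    have hci : IntervalIntegrable (fun r => ‖y r - y' r‖) volume a s := by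
      apply ContinuousOn.intervalIntegrable
      rw [uIcc_of_le hs.1]
      exact ((hc.sub hc').mono (Icc_subset_Icc_right hs.2)).norm
    have h1 : ‖∫ r in a..s, (F (y r) (d r) - F (y' r) (d r))‖
        ≤ ∫ r in a..s, L * ‖y r - y' r‖ :=
      intervalIntegral.norm_integral_le_of_norm_le hs.1
        (Eventually.of_forall fun r _ => hF.lip _ _ _ (hdD r)) (hci.const_mul L)
    rw [intervalIntegral.integral_const_mul, intervalIntegral.integral_sub hi hi'] at h1
    change ‖y s - y' s‖ ≤ ‖x - x'‖ + L * ∫ r in a..s, ‖y r - y' r‖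
    rw [hy.2 s hs, hy'.2 s hs, add_sub_add_comm]
    exact (norm_add_le _ _).trans (by linarith)
  · refine mul_le_mul_of_nonneg_left (Real.exp_le_exp.2 ?_) (norm_nonneg _)
    exact mul_le_mul_of_nonneg_left (by linarith [hs.2]) hF.nonneg_lip

/-- Carathéodory existence: every measurable uncertainty drives a trajectory. -/
theorem exists_isTraj (hF : IsLipField F D L M) (hd : Measurable d) (hdD : ∀ r, d r ∈ D)
    (hab : a ≤ b) (x : EucSp n) : ∃ y, IsTraj F d a b x y := by
  set k : ℝ := 2 * L + 1 with hk
  have hL := hF.nonneg_lip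
  have hk0 : 0 < k := by positivity
  have : Fact (a ≤ b) := ⟨hab⟩
  set Y : C(Icc a b, EucSp n) → ℝ → EucSp n :=
    fun w r => Real.exp (k * (r - a)) • w (projIcc a b hab r) with hY
  have hYc : ∀ w, Continuous (Y w) := fun w =>
    (by fun_prop : Continuous fun r => Real.exp (k * (r - a))).smul
      (w.continuous.comp continuous_projIcc)
  have hYi : ∀ w p q, IntervalIntegrable (fun r => F (Y w r) (d r)) volume p q := by
    intro w p q
    rcases le_total p q with h | h
    · exact hF.intervalIntegrable hd hdD h (hYc w).continuousOn
    · exact (hF.intervalIntegrable hd hdD h (hYc w).continuousOn).symm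
  set P : C(Icc a b, EucSp n) → C(Icc a b, EucSp n) := fun w =>
    ⟨fun s => Real.exp (-(k * (s - a))) • (x + ∫ r in a..s, F (Y w r) (d r)), by
      have h1 : Continuous fun s => ∫ r in a..s, F (Y w r) (d r) :=
        intervalIntegral.continuous_primitive (hYi w) a
      have h2 : Continuous fun s : Icc a b => ∫ r in a..(s : ℝ), F (Y w r) (d r) :=
        h1.comp continuous_subtype_val
      fun_prop⟩ with hP
  have hPc : ContractingWith (1 / 2) P := by
    refine ⟨by norm_num [← NNReal.coe_lt_coe], LipschitzWith.of_dist_le_mul fun w w' => ?_⟩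
    rw [ContinuousMap.dist_le (by positivity)]
    intro s
    have hs := s.2
    have h1 : ‖∫ r in a..(s : ℝ), (F (Y w r) (d r) - F (Y w' r) (d r))‖
        ≤ ∫ r in a..(s : ℝ), (L * dist w w') * Real.exp (k * (r - a)) := by
      refine intervalIntegral.norm_integral_le_of_norm_le hs.1
        (Eventually.of_forall fun r _ => ?_)
        ((by fun_prop : Continuous fun r : ℝ =>
          (L * dist w w') * Real.exp (k * (r - a))).intervalIntegrable _ _)
      refine (hF.lip _ _ _ (hdD r)).trans ?_
      have h2 : ‖Y w r - Y w' r‖ ≤ Real.exp (k * (r - a)) * dist w w' := by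
        rw [hY, ← smul_sub, norm_smul, Real.norm_of_nonneg (Real.exp_pos _).le, ← dist_eq_norm]
        exact mul_le_mul_of_nonneg_left (ContinuousMap.dist_apply_le_dist _) (Real.exp_pos _).le
      nlinarith [mul_le_mul_of_nonneg_left h2 hL]
    have hint : ∫ r in a..(s : ℝ), Real.exp (k * (r - a))
        = (Real.exp (k * (s - a)) - 1) / k := by
      have hder : ∀ r ∈ uIcc a (s : ℝ), HasDerivAt (fun r => Real.exp (k * (r - a)) / k)
          (Real.exp (k * (r - a))) r := by
        intro r _
        have h3 : HasDerivAt (fun r => k * (r - a)) k r := by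
          simpa using ((hasDerivAt_id r).sub_const a).const_mul k
        simpa [hk0.ne'] using h3.exp.div_const k
      rw [intervalIntegral.integral_eq_sub_of_hasDerivAt hder
        ((by fun_prop : Continuous fun r : ℝ => Real.exp (k * (r - a))).intervalIntegrable _ _)]
      simp [sub_div]
    rw [intervalIntegral.integral_const_mul, hint,
      intervalIntegral.integral_sub (hYi w _ _) (hYi w' _ _)] at h1
    change dist (Real.exp (-(k * (s - a))) • (x + ∫ r in a..(s : ℝ), F (Y w r) (d r)))
      (Real.exp (-(k * (s - a))) • (x + ∫ r in a..(s : ℝ), F (Y w' r) (d r))) ≤ _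
    rw [dist_eq_norm, ← smul_sub, norm_smul, Real.norm_of_nonneg (Real.exp_pos _).le,
      add_sub_add_left_eq_sub, Real.exp_neg, inv_mul_le_iff₀ (Real.exp_pos _)]
    refine h1.trans ?_
    have hE := Real.exp_pos (k * (s - a))
    rw [mul_div_assoc', div_le_iff₀ hk0]
    have hd0 : 0 ≤ dist w w' := dist_nonneg
    have : ((1 / 2 : NNReal) : ℝ) = 1 / 2 := by norm_num
    rw [this]
    have h5 : 0 ≤ dist w w' * Real.exp (k * (s - a)) := by positivity
    have h6 : 0 ≤ L * dist w w' := by positivity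
    rw [hk]
    nlinarith
  obtain ⟨w, hw⟩ : ∃ w, P w = w := ⟨_, hPc.fixedPoint_isFixedPt⟩
  have hsol : ∀ s ∈ Icc a b, Y w s = x + ∫ r in a..s, F (Y w r) (d r) := by
    intro s hs
    have h1 : w ⟨s, hs⟩ = Real.exp (-(k * (s - a))) • (x + ∫ r in a..s, F (Y w r) (d r)) :=
      (congrArg (fun v : C(Icc a b, EucSp n) => v ⟨s, hs⟩) hw).symm
    have h2 : Y w s = Real.exp (k * (s - a)) • w ⟨s, hs⟩ := by
      rw [hY]; simp only [projIcc_of_mem hab hs]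
    rw [h2, h1, smul_smul, ← Real.exp_add, add_neg_cancel, Real.exp_zero, one_smul]
  exact ⟨Y w, by simpa using hsol a (left_mem_Icc.2 hab), hsol⟩

end Trajectories

/-- A bound on the trajectories of duration at most `τ` starting in the ball of radius `ρ`. -/
def trajRadius (L M ρ τ : ℝ) : ℝ := (ρ + M * τ) * Real.exp (L * τ)

section Bounds

variable {n m : ℕ} {F : EucSp n → EucSp m → EucSp n} {D : Set (EucSp m)} {L M : ℝ}
  {d : ℝ → EucSp m} {a b ρ τ : ℝ} {x : EucSp n} {y : ℝ → EucSp n}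

theorem IsTraj.norm_le_trajRadius (hF : IsLipField F D L M) (hd : Measurable d)
    (hdD : ∀ r, d r ∈ D) (hab : a ≤ b) (hy : IsTraj F d a b x y) (hx : ‖x‖ ≤ ρ)
    (hτ : b - a ≤ τ) : ∀ s ∈ Icc a b, ‖y s‖ ≤ trajRadius L M ρ τ := by
  intro s hs
  refine (hy.norm_le hF hd hdD hab s hs).trans ?_
  have := hF.nonneg_lip
  have := hF.nonneg_bound
  have : 0 ≤ b - a := sub_nonneg.2 hab
  have : 0 ≤ ρ := (norm_nonneg _).trans hx
  have : 0 ≤ τ := by linarith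
  unfold trajRadius
  gcongr

theorem IsTraj.norm_sub_init_le (hF : IsLipField F D L M) (hd : Measurable d)
    (hdD : ∀ r, d r ∈ D) (hab : a ≤ b) (hy : IsTraj F d a b x y) (hx : ‖x‖ ≤ ρ)
    (hτ : b - a ≤ τ) :
    ∀ s ∈ Icc a b, ‖y s - x‖ ≤ (M + L * trajRadius L M ρ τ) * (s - a) := by
  intro s hs
  rw [hy.2 s hs, add_sub_cancel_left]
  have h := intervalIntegral.norm_integral_le_of_norm_le_const (a := a) (b := s)
    (f := fun r => F (y r) (d r)) (C := M + L * trajRadius L M ρ τ) (by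
      intro r hr
      rw [uIoc_of_le hs.1] at hr
      refine (hF.norm_le _ (hdD r)).trans ?_
      have h1 := hy.norm_le_trajRadius hF hd hdD hab hx hτ r ⟨hr.1.le, hr.2.trans hs.2⟩
      have h2 := mul_le_mul_of_nonneg_left h1 hF.nonneg_lip
      linarith)
  rwa [abs_of_nonneg (sub_nonneg.2 hs.1)] at h

end Bounds

section Value

variable {n m nX nTR : ℕ}

/-- The set of payoffs over which the value function takes the supremum. -/
def payoffSet (F : EucSp n → EucSp m → EucSp n) (D : Set (EucSp m))
    (g : Fin nX → EucSp n → ℝ → ℝ) (l : Fin nTR → EucSp n → ℝ) (T : ℝ)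
    (x : EucSp n) (t : ℝ) : Set ℝ :=
  {r | ∃ d y, Admissible D t T d ∧ IsTraj F d t T x y ∧ r = payoff g l t T y}

/-- The value function, at all times before the horizon `T`. -/
def value (F : EucSp n → EucSp m → EucSp n) (D : Set (EucSp m))
    (g : Fin nX → EucSp n → ℝ → ℝ) (l : Fin nTR → EucSp n → ℝ) (T : ℝ)
    (x : EucSp n) (t : ℝ) : ℝ :=
  sSup (payoffSet F D g l T x t)

variable {F : EucSp n → EucSp m → EucSp n} {D : Set (EucSp m)} {L M : ℝ}
  {g : Fin nX → EucSp n → ℝ → ℝ} {l : Fin nTR → EucSp n → ℝ} {T t : ℝ}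
  {d : ℝ → EucSp m} {x : EucSp n} {y : ℝ → EucSp n}

theorem payoff_le [Nonempty (Fin nX)] [Nonempty (Fin nTR)] {c : ℝ} (ht : t ≤ T)
    (hl : ∀ j, l j (y T) ≤ c) (hg : ∀ i, ∀ s ∈ Icc t T, g i (y s) s ≤ c) :
    payoff g l t T y ≤ c := by
  refine max_le (ciSup_le hl) (ciSup_le fun i => csSup_le ((nonempty_Icc.2 ht).image _) ?_)
  rintro _ ⟨s, hs, rfl⟩
  exact hg i s hs

theorem terminal_le_payoff (j : Fin nTR) : l j (y T) ≤ payoff g l t T y :=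
  (le_ciSup (f := fun j => l j (y T)) (finite_range _).bddAbove j).trans (le_max_left _ _)

theorem running_le_payoff (hg : ∀ i, Continuous fun p : EucSp n × ℝ => g i p.1 p.2)
    (hy : ContinuousOn y (Icc t T)) (i : Fin nX) {s : ℝ} (hs : s ∈ Icc t T) :
    g i (y s) s ≤ payoff g l t T y := by
  have hc : ContinuousOn (fun s => g i (y s) s) (Icc t T) :=
    (hg i).comp_continuousOn (hy.prodMk continuousOn_id)
  have h1 : g i (y s) s ≤ sSup ((fun s => g i (y s) s) '' Icc t T) :=
    le_csSup (isCompact_Icc.bddAbove_image hc) ⟨s, hs, rfl⟩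
  exact (h1.trans (le_ciSup (f := fun i => sSup ((fun s => g i (y s) s) '' Icc t T))
    (finite_range _).bddAbove i)).trans (le_max_right _ _)

/-- An admissible uncertainty can be replaced by one that takes values in `D` at all times. -/
theorem IsTraj.exists_forall_mem (hD : D.Nonempty) (ht : t ≤ T) (hd : Admissible D t T d)
    (hy : IsTraj F d t T x y) :
    ∃ e : ℝ → EucSp m, Measurable e ∧ (∀ r, e r ∈ D) ∧ IsTraj F e t T x y := by
  classical
  obtain ⟨d₀, hd₀⟩ := hD
  refine ⟨(Icc t T).piecewise d fun _ => d₀,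
    hd.1.piecewise measurableSet_Icc measurable_const, fun r => ?_,
    hy.congr ht (fun s hs => ?_) fun _ _ => rfl⟩
  · by_cases h : r ∈ Icc t T
    · simpa [h] using hd.2 r h
    · simpa [h] using hd₀
  · rw [piecewise_eq_of_mem _ _ _ (Ioc_subset_Icc_self hs)]

theorem payoffSet_nonempty (hF : IsLipField F D L M) (hD : D.Nonempty) (ht : t ≤ T) :
    (payoffSet F D g l T x t).Nonempty := by
  obtain ⟨d₀, hd₀⟩ := hD
  obtain ⟨y, hy⟩ := exists_isTraj (d := fun _ => d₀) hF measurable_const (fun _ => hd₀) ht x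
  exact ⟨_, fun _ => d₀, y, ⟨measurable_const, fun _ _ => hd₀⟩, hy, rfl⟩

theorem payoffSet_bddAbove [Nonempty (Fin nX)] [Nonempty (Fin nTR)]
    (hF : IsLipField F D L M) (hD : D.Nonempty)
    (hg : ∀ i, Continuous fun p : EucSp n × ℝ => g i p.1 p.2) (hl : ∀ j, Continuous (l j))
    (ht : t ≤ T) : BddAbove (payoffSet F D g l T x t) := by
  have hK : IsCompact (Metric.closedBall (0 : EucSp n) (trajRadius L M ‖x‖ (T - t))) :=
    isCompact_closedBall _ _
  choose A hA using fun j => hK.exists_bound_of_continuousOn (hl j).continuousOn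
  choose B hB using fun i =>
    (hK.prod (isCompact_Icc (a := t) (b := T))).exists_bound_of_continuousOn (hg i).continuousOn
  refine ⟨max (⨆ j, A j) (⨆ i, B i), ?_⟩
  rintro _ ⟨d, y, hd, hy, rfl⟩
  obtain ⟨e, he, heD, hy⟩ := hy.exists_forall_mem hD ht hd
  have hr : ∀ s ∈ Icc t T, y s ∈ Metric.closedBall (0 : EucSp n) (trajRadius L M ‖x‖ (T - t)) :=
    fun s hs => mem_closedBall_zero_iff.2
      (hy.norm_le_trajRadius hF he heD ht le_rfl le_rfl s hs)
  refine payoff_le ht (fun j => ?_) fun i s hs => ?_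
  · exact ((le_abs_self _).trans (hA j _ (hr T (right_mem_Icc.2 ht)))).trans
      ((le_ciSup (finite_range _).bddAbove j).trans (le_max_left _ _))
  · exact ((le_abs_self _).trans (hB i (y s, s) ⟨hr s hs, hs⟩)).trans
      ((le_ciSup (finite_range _).bddAbove i).trans (le_max_right _ _))

theorem payoff_le_value [Nonempty (Fin nX)] [Nonempty (Fin nTR)]
    (hF : IsLipField F D L M) (hg : ∀ i, Continuous fun p : EucSp n × ℝ => g i p.1 p.2)
    (hl : ∀ j, Continuous (l j)) (ht : t ≤ T) (hd : Measurable d) (hdD : ∀ r, d r ∈ D)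
    (hy : IsTraj F d t T x y) : payoff g l t T y ≤ value F D g l T x t :=
  le_csSup (payoffSet_bddAbove hF ⟨_, hdD 0⟩ hg hl ht)
    ⟨d, y, ⟨hd, fun s _ => hdD s⟩, hy, rfl⟩

theorem value_le (hF : IsLipField F D L M) (hD : D.Nonempty) (ht : t ≤ T) {c : ℝ}
    (h : ∀ (d : ℝ → EucSp m) (y : ℝ → EucSp n), Measurable d → (∀ r, d r ∈ D) →
      IsTraj F d t T x y → payoff g l t T y ≤ c) : value F D g l T x t ≤ c := by
  refine csSup_le (payoffSet_nonempty hF hD ht) ?_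
  rintro _ ⟨d, y, hd, hy, rfl⟩
  obtain ⟨e, he, heD, hy⟩ := hy.exists_forall_mem hD ht hd
  exact h e y he heD hy

/-- The value function does not increase along trajectories. -/
theorem value_le_value_of_isTraj [Nonempty (Fin nX)] [Nonempty (Fin nTR)]
    (hF : IsLipField F D L M) (hg : ∀ i, Continuous fun p : EucSp n × ℝ => g i p.1 p.2)
    (hl : ∀ j, Continuous (l j)) (hd : Measurable d) (hdD : ∀ r, d r ∈ D) {c : ℝ}
    (htc : t ≤ c) (hcT : c ≤ T) (hy : IsTraj F d t c x y) :
    value F D g l T (y c) c ≤ value F D g l T x t := by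
  refine value_le hF ⟨_, hdD 0⟩ hcT fun e z he heD hz => ?_
  have hcat := hy.concat hF hd hdD he heD htc hcT hz
  have hem : Measurable fun r => if r ≤ c then d r else e r :=
    Measurable.ite measurableSet_Iic hd he
  have hemD : ∀ r, (if r ≤ c then d r else e r) ∈ D := fun r => by
    split_ifs
    exacts [hdD r, heD r]
  have hext : ∀ s ∈ Icc c T, (if s ≤ c then y s else z s) = z s := by
    intro s hs
    rcases hs.1.eq_or_lt with rfl | h
    · simp [hz.1]
    · simp [h]
  refine le_trans ?_ (payoff_le_value hF hg hl (htc.trans hcT) hem hemD hcat)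
  refine payoff_le hcT (fun j => ?_) fun i s hs => ?_
  · have := terminal_le_payoff (g := g) (l := l) (t := t) (T := T)
      (y := fun r => if r ≤ c then y r else z r) j
    rwa [hext T (right_mem_Icc.2 hcT)] at this
  · have := running_le_payoff (l := l) hg (hcat.continuousOn hF hem hemD (htc.trans hcT)) i
      (s := s) ⟨htc.trans hs.1, hs.2⟩
    rwa [hext s hs] at this

theorem running_le_value [Nonempty (Fin nX)] [Nonempty (Fin nTR)]
    (hF : IsLipField F D L M) (hD : D.Nonempty)
    (hg : ∀ i, Continuous fun p : EucSp n × ℝ => g i p.1 p.2) (hl : ∀ j, Continuous (l j))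
    (ht : t ≤ T) (i : Fin nX) : g i x t ≤ value F D g l T x t := by
  obtain ⟨d₀, hd₀⟩ := hD
  obtain ⟨y, hy⟩ := exists_isTraj (d := fun _ => d₀) hF measurable_const (fun _ => hd₀) ht x
  have h := running_le_payoff (l := l) hg
    (hy.continuousOn hF measurable_const (fun _ => hd₀) ht) i (left_mem_Icc.2 ht)
  rw [hy.1] at h
  exact h.trans (payoff_le_value hF hg hl ht measurable_const (fun _ => hd₀) hy)

theorem terminal_le_value [Nonempty (Fin nX)] [Nonempty (Fin nTR)]
    (hF : IsLipField F D L M) (hD : D.Nonempty)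
    (hg : ∀ i, Continuous fun p : EucSp n × ℝ => g i p.1 p.2) (hl : ∀ j, Continuous (l j))
    (j : Fin nTR) : l j x ≤ value F D g l T x T := by
  obtain ⟨d₀, hd₀⟩ := hD
  obtain ⟨y, hy⟩ := exists_isTraj (d := fun _ => d₀) hF measurable_const (fun _ => hd₀)
    (le_refl T) x
  have h := terminal_le_payoff (g := g) (l := l) (t := T) (T := T) (y := y) j
  rw [hy.1] at h
  exact h.trans (payoff_le_value hF hg hl le_rfl measurable_const (fun _ => hd₀) hy)

/-- Trajectories driven by the same uncertainty from nearby initial data stay close. -/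
theorem IsTraj.dist_le {t₀ t' ρ δ : ℝ} {x' : EucSp n} {y' : ℝ → EucSp n}
    (hF : IsLipField F D L M) (hd : Measurable d) (hdD : ∀ r, d r ∈ D)
    (ht : t ∈ Icc t₀ T) (ht' : t' ∈ Icc t₀ T) (hx : ‖x‖ ≤ ρ) (hx' : ‖x'‖ ≤ ρ)
    (hy : IsTraj F d t T x y) (hy' : IsTraj F d t' T x' y')
    (hδ : ‖x - x'‖ ≤ δ) (hδ' : |t - t'| ≤ δ) :
    ∀ s ∈ Icc t T, dist (y s, s) (y' (max s t'), max s t') ≤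
      (1 + 2 * (M + L * trajRadius L M ρ (T - t₀))) * Real.exp (L * (T - t₀)) * δ := by
  intro s hs
  set N := M + L * trajRadius L M ρ (T - t₀) with hN
  have hL := hF.nonneg_lip
  have hM := hF.nonneg_bound
  have hρ : 0 ≤ ρ := (norm_nonneg _).trans hx
  have hτ : 0 ≤ T - t₀ := by linarith [ht.1, ht.2]
  have hN0 : 0 ≤ N := by rw [hN]; unfold trajRadius; positivity
  have hδ0 : 0 ≤ δ := (norm_nonneg _).trans hδ
  have hE : 1 ≤ Real.exp (L * (T - t₀)) := Real.one_le_exp (by positivity)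
  obtain ⟨hδ1, hδ2⟩ := abs_le.1 hδ'
  have hspeed := hy.norm_sub_init_le hF hd hdD ht.2 hx (τ := T - t₀) (by linarith [ht.1])
  have hspeed' := hy'.norm_sub_init_le hF hd hdD ht'.2 hx' (τ := T - t₀) (by linarith [ht'.1])
  rw [← hN] at hspeed hspeed'
  have hCδ : (1 + 2 * N) * δ ≤ (1 + 2 * N) * Real.exp (L * (T - t₀)) * δ := by
    nlinarith [mul_nonneg (add_nonneg zero_le_one (mul_nonneg zero_le_two hN0)) hδ0]
  have hNδ : 0 ≤ N * δ := mul_nonneg hN0 hδ0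
  rw [Prod.dist_eq]
  rcases le_or_gt t' s with h | h
  · rw [max_eq_left h]
    refine max_le ?_ (by rw [dist_self]; positivity)
    set c := max t t' with hc
    have hcT : c ≤ T := max_le ht.2 ht'.2
    have hcs : c ≤ s := max_le hs.1 h
    have hct : c - t ≤ δ := by
      rcases max_cases t t' with ⟨h1, _⟩ | ⟨h1, _⟩ <;> rw [hc, h1] <;> linarith
    have hct' : c - t' ≤ δ := by
      rcases max_cases t t' with ⟨h1, _⟩ | ⟨h1, _⟩ <;> rw [hc, h1] <;> linarith
    have h1 := hspeed c ⟨le_max_left _ _, hcT⟩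
    have h2 := hspeed' c ⟨le_max_right _ _, hcT⟩
    have h3 : ‖y c - y' c‖ ≤ (1 + 2 * N) * δ := by
      have h4 : y c - y' c = (y c - x) + (x - x') - (y' c - x') := by abel
      have h5 : ‖y c - y' c‖ ≤ ‖y c - x‖ + ‖x - x'‖ + ‖y' c - x'‖ := by
        rw [h4]
        exact (_root_.norm_sub_le _ _).trans (by gcongr; exact norm_add_le _ _)
      have h6 := mul_le_mul_of_nonneg_left hct hN0
      have h7 := mul_le_mul_of_nonneg_left hct' hN0
      linarith
    have h4 := (hy.mono_left hF hd hdD ⟨le_max_left _ _, hcT⟩).norm_sub_le hF hd hdD hcT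
      (hy'.mono_left hF hd hdD ⟨le_max_right _ _, hcT⟩) s ⟨hcs, hs.2⟩
    rw [dist_eq_norm]
    refine h4.trans ?_
    rw [mul_right_comm]
    have h5 : T - c ≤ T - t₀ := by linarith [ht.1, le_max_left t t']
    gcongr
  · rw [max_eq_right h.le, hy'.1]
    refine (max_le ?_ ?_).trans hCδ
    · have h1 := hspeed s hs
      have h2 := mul_le_mul_of_nonneg_left (by linarith : s - t ≤ δ) hN0
      rw [dist_eq_norm, ← sub_add_sub_cancel (y s) x x']
      exact (norm_add_le _ _).trans (by linarith)
    · rw [Real.dist_eq, abs_le]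
      constructor <;> linarith [hs.1]

/-- The value function is Lipschitz on bounded sets. -/
theorem exists_lipschitzOnWith_value [Nonempty (Fin nX)] [Nonempty (Fin nTR)]
    (hF : IsLipField F D L M) (hD : D.Nonempty)
    (hg : ∀ i, LocallyLipschitz fun p : EucSp n × ℝ => g i p.1 p.2)
    (hl : ∀ j, LocallyLipschitz (l j)) (ρ t₀ : ℝ) :
    ∃ K : NNReal, LipschitzOnWith K (fun p : EucSp n × ℝ => value F D g l T p.1 p.2)
      (Metric.closedBall 0 ρ ×ˢ Icc t₀ T) := by
  set r := trajRadius L M ρ (T - t₀) with hr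
  have hK : IsCompact (Metric.closedBall (0 : EucSp n) r) := isCompact_closedBall _ _
  choose A hA using fun j =>
    ((hl j).locallyLipschitzOn (s := Metric.closedBall 0 r)).exists_lipschitzOnWith_of_compact hK
  choose B hB using fun i =>
    ((hg i).locallyLipschitzOn
      (s := Metric.closedBall 0 r ×ˢ Icc t₀ T)).exists_lipschitzOnWith_of_compact
      (hK.prod isCompact_Icc)
  set S : NNReal := max (⨆ j, A j) (⨆ i, B i) with hS
  have hAS : ∀ j, A j ≤ S := fun j =>
    (le_ciSup (finite_range _).bddAbove j).trans (le_max_left _ _)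
  have hBS : ∀ i, B i ≤ S := fun i =>
    (le_ciSup (finite_range _).bddAbove i).trans (le_max_right _ _)
  set C := (1 + 2 * (M + L * r)) * Real.exp (L * (T - t₀)) with hC
  refine ⟨S * C.toNNReal, LipschitzOnWith.of_le_add_mul _ ?_⟩
  rintro ⟨x, t⟩ ⟨hx, ht⟩ ⟨x', t'⟩ ⟨hx', ht'⟩
  simp only [mem_closedBall_zero_iff] at hx hx' ht ht'
  have hgc : ∀ i, Continuous fun p : EucSp n × ℝ => g i p.1 p.2 := fun i => (hg i).continuous
  have hlc : ∀ j, Continuous (l j) := fun j => (hl j).continuous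
  refine value_le hF hD ht.2 fun d y hd hdD hy => ?_
  obtain ⟨y', hy'⟩ := exists_isTraj hF hd hdD ht'.2 x'
  have hδ : ‖x - x'‖ ≤ dist (x, t) (x', t') := by
    rw [← dist_eq_norm]; exact le_max_left _ _
  have hδ' : |t - t'| ≤ dist (x, t) (x', t') := by
    rw [← Real.dist_eq]; exact le_max_right _ _
  have hdist := hy.dist_le hF hd hdD ht ht' hx hx' hy' hδ hδ'
  rw [← hr, ← hC] at hdist
  have hval := payoff_le_value hF hgc hlc ht'.2 hd hdD hy'
  have hyr := hy.norm_le_trajRadius hF hd hdD ht.2 hx (τ := T - t₀) (by linarith [ht.1])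
  have hyr' := hy'.norm_le_trajRadius hF hd hdD ht'.2 hx' (τ := T - t₀) (by linarith [ht'.1])
  have hCS : ∀ {z z' : ℝ} {k : NNReal} {δ : ℝ}, k ≤ S → dist z z' ≤ k * δ →
      0 ≤ δ → δ ≤ C * dist (x, t) (x', t') →
      z' ≤ value F D g l T x' t' →
      z ≤ value F D g l T x' t' + (S * C.toNNReal : NNReal) * dist (x, t) (x', t') := by
    intro z z' k δ hk hz hδ0 hδ hz'
    have h1 : (k : ℝ) * δ ≤ S * (C.toNNReal * dist (x, t) (x', t')) := by
      have : (k : ℝ) ≤ S := hk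
      have h2 : C ≤ C.toNNReal := Real.le_coe_toNNReal C
      have h3 : δ ≤ C.toNNReal * dist (x, t) (x', t') :=
        hδ.trans (mul_le_mul_of_nonneg_right h2 dist_nonneg)
      gcongr
    have h2 := (abs_le.1 (Real.dist_eq z z' ▸ hz)).2
    push_cast
    rw [mul_assoc]
    linarith
  refine payoff_le ht.2 (fun j => ?_) fun i s hs => ?_
  · have hT := hdist T (right_mem_Icc.2 ht.2)
    rw [max_eq_left ht'.2] at hT
    refine hCS (hAS j) ((hA j).dist_le_mul _ (mem_closedBall_zero_iff.2
      (hyr T (right_mem_Icc.2 ht.2))) _ (mem_closedBall_zero_iff.2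
      (hyr' T (right_mem_Icc.2 ht'.2)))) dist_nonneg ((le_max_left _ _).trans hT)
      ((terminal_le_payoff j).trans hval)
  · have hs' : max s t' ∈ Icc t' T := ⟨le_max_right _ _, max_le hs.2 ht'.2⟩
    exact hCS (hBS i) ((hB i).dist_le_mul (y s, s)
      ⟨mem_closedBall_zero_iff.2 (hyr s hs), ht.1.trans hs.1, hs.2⟩ (y' (max s t'), max s t')
      ⟨mem_closedBall_zero_iff.2 (hyr' _ hs'), ht'.1.trans hs'.1, hs'.2⟩) dist_nonneg
      (hdist s hs) ((running_le_payoff hgc (hy'.continuousOn hF hd hdD ht'.2) i hs').trans hval)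

end Value

section Mollification

variable {G : Type*} [NormedAddCommGroup G] [NormedSpace ℝ G]

/-- Mollification at scale `η` of a continuous function, together with the one-sided bounds on
increments that it inherits. -/
theorem exists_contDiff_mollification [FiniteDimensional ℝ G] {W : G → ℝ} (hW : Continuous W)
    {η : ℝ} (hη : 0 < η) :
    ∃ Ψ : G → ℝ, ContDiff ℝ (⊤ : ℕ∞) Ψ ∧
      (∀ p c, (∀ q ∈ Metric.ball p η, dist (W q) (W p) ≤ c) → dist (Ψ p) (W p) ≤ c) ∧
      ∀ p v c, (∀ q ∈ Metric.ball p η, W (q + v) - W q ≤ c) → Ψ (p + v) - Ψ p ≤ c := by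
  borelize G
  let μ : Measure G := Measure.addHaar
  let φ : ContDiffBump (0 : G) := ⟨η / 2, η, half_pos hη, half_lt_self hη⟩
  have hφc : Continuous (φ.normed μ) := φ.continuous_normed
  have hint : ∀ p, Integrable (fun z => φ.normed μ z * W (p - z)) μ := fun p =>
    (hφc.mul (hW.comp (continuous_const.sub continuous_id))).integrable_of_hasCompactSupport
      φ.hasCompactSupport_normed.mul_right
  refine ⟨convolution (φ.normed μ) W (ContinuousLinearMap.lsmul ℝ ℝ) μ,
    φ.hasCompactSupport_normed.contDiff_convolution_left _ φ.contDiff_normed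
      hW.locallyIntegrable,
    fun p c h => φ.dist_normed_convolution_le hW.aestronglyMeasurable h, fun p v c h => ?_⟩
  change (∫ z, φ.normed μ z * W (p + v - z) ∂μ) - (∫ z, φ.normed μ z * W (p - z) ∂μ) ≤ c
  rw [← integral_sub (hint _) (hint _)]
  calc ∫ z, (φ.normed μ z * W (p + v - z) - φ.normed μ z * W (p - z)) ∂μ
      ≤ ∫ z, φ.normed μ z * c ∂μ := by
        refine integral_mono ((hint _).sub (hint _)) (φ.integrable_normed.mul_const c) fun z => ?_
        change φ.normed μ z * W (p + v - z) - φ.normed μ z * W (p - z) ≤ φ.normed μ z * c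
        rw [← mul_sub]
        by_cases hz : z ∈ Metric.ball (0 : G) η
        · refine mul_le_mul_of_nonneg_left ?_ (φ.nonneg_normed z)
          have hq : p - z ∈ Metric.ball p η := by
            rw [mem_ball_zero_iff] at hz
            simpa [Metric.mem_ball, dist_eq_norm] using hz
          rw [add_sub_right_comm]
          exact h _ hq
        · have : φ.normed μ z = 0 := by
            by_contra h0
            have : z ∈ Function.support (φ.normed μ) := h0
            rw [φ.support_normed_eq] at this
            exact hz this
          rw [this, zero_mul, zero_mul]
    _ = c := by rw [integral_mul_const, φ.integral_normed, one_mul]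

theorem fderiv_apply_le_of_eventually_le {Ψ : G → ℝ} {p v : G} {c : ℝ}
    (hΨ : DifferentiableAt ℝ Ψ p)
    (h : ∀ᶠ r in 𝓝[>] (0 : ℝ), Ψ (p + r • v) - Ψ p ≤ c * r) : fderiv ℝ Ψ p v ≤ c := by
  have hd : HasDerivAt (fun r : ℝ => Ψ (p + r • v)) (fderiv ℝ Ψ p v) 0 :=
    hΨ.hasFDerivAt.hasLineDerivAt v
  have ht := hd.hasDerivWithinAt (s := Ioi 0)
  rw [hasDerivWithinAt_iff_tendsto_slope' (by simp)] at ht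
  refine le_of_tendsto ht ?_
  filter_upwards [h, self_mem_nhdsWithin] with r hr hr0
  have hr0 : 0 < r := hr0
  rw [slope_def_field, sub_zero, zero_smul, add_zero, div_le_iff₀ hr0]
  exact hr

end Mollification

/-- Increments of a Lipschitz extension of the value function along a frozen velocity. -/
theorem increment_le {n m nX nTR : ℕ} [Nonempty (Fin nX)] [Nonempty (Fin nTR)]
    {F : EucSp n → EucSp m → EucSp n} {D : Set (EucSp m)} {L M : ℝ}
    {g : Fin nX → EucSp n → ℝ → ℝ} {l : Fin nTR → EucSp n → ℝ} {T t₀ ρ η h : ℝ}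
    (hF : IsLipField F D L M) (hg : ∀ i, Continuous fun p : EucSp n × ℝ => g i p.1 p.2)
    (hl : ∀ j, Continuous (l j)) {K : NNReal} {W : EucSp n × ℝ → ℝ} (hWK : LipschitzWith K W)
    (hW : EqOn (fun p : EucSp n × ℝ => value F D g l T p.1 p.2) W
      (Metric.closedBall 0 ρ ×ˢ Icc t₀ T))
    {x : EucSp n} {d : EucSp m} (hd : d ∈ D) (hx : ‖x‖ + 2 * η ≤ ρ)
    (hh : 0 < h) (hh' : (M + L * trajRadius L M ρ (T - t₀)) * h ≤ η)
    {q : EucSp n × ℝ} (hq : ‖q.1 - x‖ ≤ η) (hq₀ : t₀ ≤ q.2) (hqT : q.2 + h ≤ T) :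
    W (q + h • (F x d, (1 : ℝ))) - W q ≤ K * L * (2 * η) * h := by
  obtain ⟨x', τ⟩ := q
  simp only at hq hq₀ hqT
  have hη : 0 ≤ η := (norm_nonneg _).trans hq
  have hx' : ‖x'‖ ≤ ‖x‖ + η := by
    have := norm_le_norm_add_norm_sub' x' x
    linarith
  have hτh : τ ≤ τ + h := by linarith
  obtain ⟨y, hy⟩ := exists_isTraj (d := fun _ => d) hF measurable_const (fun _ => hd) hτh x'
  have hspeed := hy.norm_sub_init_le hF measurable_const (fun _ => hd) hτh
    (by linarith : ‖x'‖ ≤ ρ) (τ := T - t₀) (by linarith)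
  have hclose : ∀ s ∈ Icc τ (τ + h), ‖y s - x'‖ ≤ η := by
    intro s hs
    refine (hspeed s hs).trans (le_trans ?_ hh')
    have hN : 0 ≤ M + L * trajRadius L M ρ (T - t₀) := by
      have := hF.nonneg_lip
      have := hF.nonneg_bound
      have : 0 ≤ T - t₀ := by linarith
      have : 0 ≤ ρ := by linarith [norm_nonneg x]
      unfold trajRadius
      positivity
    exact mul_le_mul_of_nonneg_left (by linarith [hs.2]) hN
  have hend : τ + h ∈ Icc τ (τ + h) := right_mem_Icc.2 hτh
  have hyρ : ‖y (τ + h)‖ ≤ ρ := by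
    have := norm_le_norm_add_norm_sub' (y (τ + h)) x'
    linarith [hclose _ hend]
  have hV := value_le_value_of_isTraj hF hg hl measurable_const (fun _ => hd) hτh hqT hy
  have h1 : value F D g l T (y (τ + h)) (τ + h) = W (y (τ + h), τ + h) :=
    hW (x := (y (τ + h), τ + h)) ⟨mem_closedBall_zero_iff.2 hyρ, by linarith, hqT⟩
  have h2 : value F D g l T x' τ = W (x', τ) :=
    hW (x := (x', τ)) ⟨mem_closedBall_zero_iff.2 (by simp only; linarith), hq₀,
      by simp only; linarith⟩
  have h3 : ‖x' + h • F x d - y (τ + h)‖ ≤ L * (2 * η) * h := by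
    have hi := hy.intervalIntegrable hF measurable_const (fun _ => hd) hτh
    have h4 : x' + h • F x d - y (τ + h) = ∫ r in τ..(τ + h), (F x d - F (y r) d) := by
      rw [intervalIntegral.integral_sub intervalIntegrable_const hi, hy.2 _ hend,
        intervalIntegral.integral_const, add_sub_cancel_left]
      abel
    rw [h4]
    have h5 := intervalIntegral.norm_integral_le_of_norm_le_const (a := τ) (b := τ + h)
      (f := fun r => F x d - F (y r) d) (C := L * (2 * η)) (by
        intro r hr
        rw [uIoc_of_le hτh] at hr
        refine (hF.lip _ _ _ hd).trans (mul_le_mul_of_nonneg_left ?_ hF.nonneg_lip)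
        have h6 := hclose r (Ioc_subset_Icc_self hr)
        rw [norm_sub_rev, ← sub_add_sub_cancel (y r) x' x]
        exact (norm_add_le _ _).trans (by linarith))
    rwa [add_sub_cancel_left, abs_of_pos hh] at h5
  have h4 : W ((x', τ) + h • (F x d, (1 : ℝ))) - W (y (τ + h), τ + h)
      ≤ K * (L * (2 * η) * h) := by
    refine (le_abs_self _).trans ?_
    rw [← Real.dist_eq]
    refine (hWK.dist_le_mul _ _).trans (mul_le_mul_of_nonneg_left ?_ K.2)
    have h0 : 0 ≤ L * (2 * η) * h := (norm_nonneg _).trans h3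
    rw [Prod.dist_eq]
    refine max_le ?_ ?_
    · simpa [dist_eq_norm] using h3
    · simpa using h0
  have h5 : (K : ℝ) * (L * (2 * η) * h) = K * L * (2 * η) * h := by ring
  linarith

/-- For every `ε > 0` there is a smooth function on a neighbourhood of
`B × [0, T]` which is a one-sided uniform `ε`-approximation of the value function and
satisfies the decrease and domination constraints on `B × [0, T]`. -/
theorem stmt11
    {n m nX nTR : ℕ} (hn : 0 < n) (hm : 0 < m) (hnX : 0 < nX) (hnTR : 0 < nTR)
    (T : ℝ) (hT : 0 < T)
    (D : Set (EucSp m)) (hDne : D.Nonempty) (hDcomp : IsCompact D)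
    (F : EucSp n → EucSp m → EucSp n)
    (hFcont : Continuous fun p : EucSp n × EucSp m => F p.1 p.2)
    (LF : ℝ) (hLF : 0 ≤ LF)
    (hFlip : ∀ x y : EucSp n, ∀ d ∈ D, ‖F x d - F y d‖ ≤ LF * ‖x - y‖)
    (g : Fin nX → EucSp n → ℝ → ℝ) (l : Fin nTR → EucSp n → ℝ)
    (hg : ∀ i, LocallyLipschitz fun p : EucSp n × ℝ => g i p.1 p.2)
    (hl : ∀ j, LocallyLipschitz (l j))
    (u : EucSp n → ℝ → ℝ) (hu : IsValueFun F D g l T u)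
    (f : EucSp n → EucSp m → EucSp n)
    (hfcont : Continuous fun p : EucSp n × EucSp m => f p.1 p.2)
    (hflip : ∀ K : Set (EucSp n), IsCompact K → ∃ L, 0 ≤ L ∧
      ∀ x ∈ K, ∀ y ∈ K, ∀ d ∈ D, ‖f x d - f y d‖ ≤ L * ‖x - y‖)
    (R : ℝ) (hR : 0 < R)
    (Bset : Set (EucSp n)) (hB : Bset = {x : EucSp n | ∑ i, x i ^ 2 ≤ R})
    (hFf : ∀ x ∈ Bset, ∀ d ∈ D, F x d = f x d)
    (hXB : ∀ t ∈ Set.Icc (0:ℝ) T, {x : EucSp n | ∀ i, g i x t ≤ 0} ⊆ Bset)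
    (hTRB : {x : EucSp n | ∀ j, l j x ≤ 0} ⊆ Bset)
 :
    ∀ ε : ℝ, 0 < ε → ∃ (ψ : EucSp n → ℝ → ℝ) (U : Set (EucSp n × ℝ)),
      IsOpen U ∧ Bset ×ˢ Set.Icc (0:ℝ) T ⊆ U ∧
      ContDiffOn ℝ (⊤ : ℕ∞) (fun p : EucSp n × ℝ => ψ p.1 p.2) U ∧
      (∀ x ∈ Bset, ∀ t ∈ Set.Icc (0:ℝ) T,
        u x t ≤ ψ x t ∧ ψ x t ≤ u x t + (T + 2) * ε) ∧
      (∀ x ∈ Bset, ∀ t ∈ Set.Icc (0:ℝ) T, ∀ d ∈ D,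
        deriv (ψ x) t + ⟪gradient (fun z => ψ z t) x, f x d⟫ ≤ 0) ∧
      (∀ x ∈ Bset, ∀ t ∈ Set.Icc (0:ℝ) T, ∀ i, g i x t ≤ ψ x t) ∧
      (∀ x ∈ Bset, ∀ j, l j x ≤ ψ x T) := by
  intro ε hε
  have : Nonempty (Fin nX) := ⟨⟨0, hnX⟩⟩
  have : Nonempty (Fin nTR) := ⟨⟨0, hnTR⟩⟩
  obtain ⟨M, hM⟩ := hDcomp.exists_bound_of_continuousOn
    (hFcont.comp (continuous_const.prodMk continuous_id) :
      Continuous fun d => F 0 d).continuousOn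
  have hF : IsLipField F D LF M :=
    ⟨hFcont, hLF, (norm_nonneg _).trans (hM _ hDne.some_mem), hFlip, hM⟩
  have hgc : ∀ i, Continuous fun p : EucSp n × ℝ => g i p.1 p.2 := fun i => (hg i).continuous
  have hlc : ∀ j, Continuous (l j) := fun j => (hl j).continuous
  have huV : ∀ x, ∀ t ∈ Icc (0 : ℝ) T, u x t = value F D g l T x t := fun x t ht => hu x t ht
  have hBnorm : ∀ x ∈ Bset, ‖x‖ ≤ √R := by
    intro x hx
    rw [hB] at hx
    rw [EuclideanSpace.norm_eq]
    exact Real.sqrt_le_sqrt (by simpa using hx)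
  set ρ : ℝ := √R + 2 with hρ
  obtain ⟨K, hK⟩ := exists_lipschitzOnWith_value (T := T) hF hDne hg hl ρ (-1)
  obtain ⟨W, hWK, hW⟩ := hK.extend_real
  set c : ℝ := 3 * K + K * LF * 2 + 1 with hc
  have hK0 : (0 : ℝ) ≤ K := K.2
  have hc0 : 0 < c := by positivity
  obtain ⟨η, hη, hη1, hηc⟩ : ∃ η : ℝ, 0 < η ∧ η ≤ 1 / 3 ∧ η * c ≤ ε :=
    ⟨min (1 / 3) (ε / c), by positivity, min_le_left _ _,
      (le_div_iff₀ hc0).1 (min_le_right _ _)⟩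
  have hηK : 3 * K * η ≤ ε := by
    have : 0 ≤ K * LF * 2 * η := by positivity
    nlinarith
  have hηL : K * LF * (2 * η) ≤ ε := by nlinarith
  obtain ⟨Ψ, hΨ, hΨW, hΨinc⟩ := exists_contDiff_mollification hWK.continuous hη
  have hclose : ∀ x ∈ Bset, ∀ t ∈ Icc (0 : ℝ) T, |Ψ (x, t - 2 * η) - u x t| ≤ ε := by
    intro x hx t ht
    have hWu : u x t = W (x, t) := by
      rw [huV x t ht]
      exact hW (x := (x, t)) ⟨mem_closedBall_zero_iff.2 (by linarith [hBnorm x hx]),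
        by linarith [ht.1], ht.2⟩
    have h1 : dist (Ψ (x, t - 2 * η)) (W (x, t - 2 * η)) ≤ K * η := hΨW _ _ fun q hq =>
      (hWK.dist_le_mul _ _).trans (mul_le_mul_of_nonneg_left (Metric.mem_ball.1 hq).le hK0)
    have h2 : dist (W (x, t - 2 * η)) (W (x, t)) ≤ K * (2 * η) := by
      refine (hWK.dist_le_mul _ _).trans (mul_le_mul_of_nonneg_left ?_ hK0)
      simp [Prod.dist_eq, abs_of_pos hη, hη.le]
    rw [hWu, ← Real.dist_eq]
    exact (dist_triangle _ _ _).trans (by linarith)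
  have hdecr : ∀ x ∈ Bset, ∀ t ∈ Icc (0 : ℝ) T, ∀ d ∈ D,
      fderiv ℝ Ψ (x, t - 2 * η) (F x d, 1) ≤ ε := by
    intro x hx t ht d hd
    refine fderiv_apply_le_of_eventually_le (hΨ.differentiable (by simp) _) ?_
    have hsmall : ∀ᶠ h in 𝓝[>] (0 : ℝ),
        (M + LF * trajRadius LF M ρ (T - -1)) * h < η := by
      have hcont : Continuous fun h : ℝ => (M + LF * trajRadius LF M ρ (T - -1)) * h := by
        fun_prop
      exact ((hcont.tendsto 0).mono_left nhdsWithin_le_nhds).eventually_lt_const (by simpa using hη)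
    filter_upwards [hsmall, self_mem_nhdsWithin, nhdsWithin_le_nhds (Iio_mem_nhds hη)]
      with h hh hh0 hhη
    have hh0 : 0 < h := hh0
    have hhη : h < η := hhη
    refine hΨinc _ _ _ fun q hq => ?_
    rw [Metric.mem_ball, Prod.dist_eq, max_lt_iff] at hq
    obtain ⟨hq1, hq2⟩ := hq
    rw [Real.dist_eq, abs_lt] at hq2
    refine (increment_le hF hgc hlc hWK hW hd (by linarith [hBnorm x hx]) hh0 hh.le
      (by rw [← dist_eq_norm]; exact hq1.le) ?_ ?_).trans
      (mul_le_mul_of_nonneg_right hηL hh0.le)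
    · simp only at hq2
      linarith [ht.1]
    · simp only at hq2
      linarith [ht.2]
  have hbounds : ∀ x ∈ Bset, ∀ t ∈ Icc (0 : ℝ) T,
      u x t ≤ Ψ (x, t - 2 * η) + ε + ε * (T - t) ∧
        Ψ (x, t - 2 * η) + ε + ε * (T - t) ≤ u x t + (T + 2) * ε := by
    intro x hx t ht
    obtain ⟨h1, h2⟩ := abs_le.1 (hclose x hx t ht)
    have h3 : 0 ≤ ε * (T - t) := mul_nonneg hε.le (by linarith [ht.2])
    have h4 : 0 ≤ ε * t := mul_nonneg hε.le ht.1
    constructor <;> nlinarith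
  refine ⟨fun x t => Ψ (x, t - 2 * η) + ε + ε * (T - t), univ, isOpen_univ, subset_univ _,
    ?_, hbounds, fun x hx t ht d hd => ?_, fun x hx t ht i => ?_, fun x hx j => ?_⟩
  · refine ContDiff.contDiffOn ?_
    have : ContDiff ℝ (⊤ : ℕ∞) fun p : EucSp n × ℝ => Ψ (p.1, p.2 - 2 * η) :=
      hΨ.comp (contDiff_fst.prodMk (contDiff_snd.sub contDiff_const))
    exact (this.add contDiff_const).add (contDiff_const.mul (contDiff_const.sub contDiff_snd))
  · have hΨd : HasFDerivAt Ψ (fderiv ℝ Ψ (x, t - 2 * η)) (x, t - 2 * η) :=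
      (hΨ.differentiable (by simp) _).hasFDerivAt
    have h1 : HasDerivAt (fun t => Ψ (x, t - 2 * η) + ε + ε * (T - t))
        (fderiv ℝ Ψ (x, t - 2 * η) (0, 1) + ε * (-1)) t := by
      have h2 : HasDerivAt (fun t : ℝ => (x, t - 2 * η)) ((0 : EucSp n), (1 : ℝ)) t :=
        (hasDerivAt_const t x).prodMk ((hasDerivAt_id t).sub_const _)
      exact ((hΨd.comp_hasDerivAt t h2).add_const ε).add
        (((hasDerivAt_id t).const_sub T).const_mul ε)
    have h3 : HasFDerivAt (fun z => Ψ (z, t - 2 * η) + ε + ε * (T - t))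
        ((fderiv ℝ Ψ (x, t - 2 * η)).comp (ContinuousLinearMap.inl ℝ (EucSp n) ℝ)) x :=
      ((hΨd.comp x (hasFDerivAt_prodMk_left x (t - 2 * η))).add_const ε).add_const _
    rw [h1.deriv, gradient, InnerProductSpace.toDual_symm_apply, h3.fderiv, ← hFf x hx d hd]
    have h4 := hdecr x hx t ht d hd
    have h5 : ((F x d, 1) : EucSp n × ℝ) = (0, 1) + (F x d, 0) := by simp
    rw [h5, map_add] at h4
    simp only [ContinuousLinearMap.comp_apply, ContinuousLinearMap.inl_apply]
    linarith
  · refine le_trans ?_ (hbounds x hx t ht).1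
    rw [huV x t ht]
    exact running_le_value hF hDne hgc hlc ht.2 i
  · have hTT : T ∈ Icc (0 : ℝ) T := right_mem_Icc.2 hT.le
    refine le_trans ?_ (hbounds x hx T hTT).1
    rw [huV x T hTT]
    exact terminal_le_value hF hDne hgc hlc j

end
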